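/- In the multi-server secure aggregation model, assume only the structural and correctness constraints. For any u' ∈ [U], any 𝒱 ⊆ [V_{u'}], and any subset 𝒯 ⊆ 𝒦 such that {(u',v) : v ∈ 𝒱} ∩ 𝒯 = ∅, it holds that H({X_{u',v}}_{v∈𝒱} | {W_{i,j}, Z_{i,j}}_{(i,j)∈𝒯}) ≥ |𝒱|·L. -/

import Mathlib

open Finset

open scoped Classical

noncomputable section

/-- Probability that the random variable `X` takes the value `s`, under the weights `μ`. -/
def prb {Ω : Type} [Fintype Ω] (μ : Ω → ℝ) {α : Type} (X : Ω → α) (s : α) : ℝ :=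
  ∑ ω ∈ Finset.univ.filter fun ω => X ω = s, μ ω

/-- Shannon entropy of `X` in `q`-ary units. -/
def ent (q : ℕ) {Ω : Type} [Fintype Ω] (μ : Ω → ℝ) {α : Type} [Fintype α] (X : Ω → α) : ℝ :=
  -∑ s : α, prb μ X s * Real.logb q (prb μ X s)

/-- Conditional entropy `H(X | Y)` in `q`-ary units. -/
def condEnt (q : ℕ) {Ω : Type} [Fintype Ω] (μ : Ω → ℝ) {α β : Type} [Fintype α] [Fintype β]
    (X : Ω → α) (Y : Ω → β) : ℝ :=
  ent q μ (fun ω => (X ω, Y ω)) - ent q μ Y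

/-- Conditional mutual information `I(X ; Y ∣ Z)` in `q`-ary units. -/
def mutInfo (q : ℕ) {Ω : Type} [Fintype Ω] (μ : Ω → ℝ) {α β γ : Type}
    [Fintype α] [Fintype β] [Fintype γ] (X : Ω → α) (Y : Ω → β) (Z : Ω → γ) : ℝ :=
  condEnt q μ X Z - condEnt q μ X fun ω => (Y ω, Z ω)

/-- The joint random variable formed by the members of a family of random variables
indexed by a finset. -/
def restr {Ω ι α : Type} (Z : ι → Ω → α) (T : Finset ι) : Ω → { i // i ∈ T } → α :=
  fun ω i => Z i.1 ω

/-- The set of users `𝒦`: user `⟨u,v⟩` is the `v`-th user of server `u`. -/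
abbrev Usr (U : ℕ) (V : Fin U → ℕ) : Type := Σ u : Fin U, Fin (V u)

/-- Total number of users, `K = ∑ u, V u`. -/
def Ktot (U : ℕ) (V : Fin U → ℕ) : ℕ := ∑ u, V u

/-- The users connected to server `u`, `𝒦_{{u}}`. -/
def Ksrv (U : ℕ) (V : Fin U → ℕ) (u : Fin U) : Finset (Usr U V) :=
  Finset.univ.filter fun i => i.1 = u

/-- The users connected to a set of servers, `𝒦_𝒰`. -/
def KsrvSet (U : ℕ) (V : Fin U → ℕ) (A : Finset (Fin U)) : Finset (Usr U V) :=
  Finset.univ.filter fun i => i.1 ∈ A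

/-- The set of servers `𝒰^{(m,n)}` associated with a security input set `Sm` and a
colluding set `Tn`. -/
def UServers (U : ℕ) (V : Fin U → ℕ) (Sm Tn : Finset (Usr U V)) : Finset (Fin U) :=
  Finset.univ.filter fun u =>
    (Sm ∩ Ksrv U V u).Nonempty ∧ ((Sm ∪ Tn) ∩ Ksrv U V u).card = V u

/-- The set `(𝒮_m ∩ 𝒦_{{u}}) ∪ 𝒦_{𝒰^{(m,n)}} ∪ 𝒯_n`. -/
def BigB (U : ℕ) (V : Fin U → ℕ) (Sm Tn : Finset (Usr U V)) (u : Fin U) : Finset (Usr U V) :=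
  (Sm ∩ Ksrv U V u) ∪ KsrvSet U V (UServers U V Sm Tn) ∪ Tn

/-- The implicit security input set `𝒮_I`. -/
def SImp (U : ℕ) (V : Fin U → ℕ) {M N : ℕ} (S : Fin M → Finset (Usr U V))
    (T : Fin N → Finset (Usr U V)) : Finset (Usr U V) :=
  Finset.univ.filter fun i =>
    (∀ m, i ∉ S m) ∧
    ∃ u m n, (BigB U V (S m) (T n) u).card = Ktot U V - 1 ∧ i ∉ BigB U V (S m) (T n) u

/-- The total security input set `𝒮̄`. -/
def Sbar (U : ℕ) (V : Fin U → ℕ) {M N : ℕ} (S : Fin M → Finset (Usr U V))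
    (T : Fin N → Finset (Usr U V)) : Finset (Usr U V) :=
  (Finset.univ.biUnion fun m => S m) ∪ SImp U V S T

/-- The set `𝒜_{u,m,n}`. -/
def Aset (U : ℕ) (V : Fin U → ℕ) {M N : ℕ} (S : Fin M → Finset (Usr U V))
    (T : Fin N → Finset (Usr U V)) (u : Fin U) (m : Fin M) (n : Fin N) : Finset (Usr U V) :=
  BigB U V (S m) (T n) u ∩ Sbar U V S T

/-- `a* = max_{u,m,n} |𝒜_{u,m,n}|`. -/
def aStar (U : ℕ) (V : Fin U → ℕ) {M N : ℕ} (S : Fin M → Finset (Usr U V))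
    (T : Fin N → Finset (Usr U V)) : ℕ :=
  Finset.univ.sup fun t : Fin U × Fin M × Fin N => (Aset U V S T t.1 t.2.1 t.2.2).card

/-- `|((𝒮_m ∩ 𝒦_{{u}}) ∪ 𝒯_n) ∩ 𝒮̄| + |𝒰^{(m,n)} ∖ {u}|`. -/
def eVal (U : ℕ) (V : Fin U → ℕ) {M N : ℕ} (S : Fin M → Finset (Usr U V))
    (T : Fin N → Finset (Usr U V)) (u : Fin U) (m : Fin M) (n : Fin N) : ℕ :=
  (((S m ∩ Ksrv U V u) ∪ T n) ∩ Sbar U V S T).card + ((UServers U V (S m) (T n)).erase u).card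

/-- `e* = max_{u,m,n} (|((𝒮_m ∩ 𝒦_{{u}}) ∪ 𝒯_n) ∩ 𝒮̄| + |𝒰^{(m,n)} ∖ {u}|)`. -/
def eStar (U : ℕ) (V : Fin U → ℕ) {M N : ℕ} (S : Fin M → Finset (Usr U V))
    (T : Fin N → Finset (Usr U V)) : ℕ :=
  Finset.univ.sup fun t : Fin U × Fin M × Fin N => eVal U V S T t.1 t.2.1 t.2.2

/-- The set `𝒬_1`. -/
def Q1set (U : ℕ) (V : Fin U → ℕ) {M N : ℕ} (S : Fin M → Finset (Usr U V))
    (T : Fin N → Finset (Usr U V)) : Finset (Usr U V) :=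
  (Finset.univ.filter fun t : Fin U × Fin M × Fin N =>
      (Aset U V S T t.1 t.2.1 t.2.2).card = (Sbar U V S T).card).biUnion
    fun t => BigB U V (S t.2.1) (T t.2.2) t.1

/-- The set `𝒬_2`. -/
def Q2set (U : ℕ) (V : Fin U → ℕ) {M N : ℕ} (S : Fin M → Finset (Usr U V))
    (T : Fin N → Finset (Usr U V)) : Finset (Usr U V) :=
  (Finset.univ.filter fun t : Fin U × Fin M × Fin N =>
      eVal U V S T t.1 t.2.1 t.2.2 = eStar U V S T).biUnion
    fun t => BigB U V (S t.2.1) (T t.2.2) t.1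

/-- The set `𝒬`. -/
def Qset (U : ℕ) (V : Fin U → ℕ) {M N : ℕ} (S : Fin M → Finset (Usr U V))
    (T : Fin N → Finset (Usr U V)) : Finset (Usr U V) :=
  if (Q1set U V S T).Nonempty then Q1set U V S T ∪ Q2set U V S T else ∅

/-- A secure-aggregation scheme: all structural, distributional, correctness and
security constraints of the multi-server secure aggregation model, with entropies in
`q`-ary units for `q = |F|`. -/
def IsScheme (U : ℕ) (V : Fin U → ℕ) (M N : ℕ) (S : Fin M → Finset (Usr U V))
    (T : Fin N → Finset (Usr U V)) (F : Type) [Field F] [Fintype F]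
    (Ω : Type) [Fintype Ω] (μ : Ω → ℝ) (L LX LY LZ LSig : ℕ)
    (W : Usr U V → Ω → Fin L → F) (Z : Usr U V → Ω → Fin LZ → F)
    (X : Usr U V → Ω → Fin LX → F) (Y : Fin U → Ω → Fin LY → F)
    (ZS : Ω → Fin LSig → F) : Prop :=
  let q := Fintype.card F
  (1 ≤ L) ∧
  (∀ ω, 0 ≤ μ ω) ∧ (∑ ω, μ ω = 1) ∧
  -- each input consists of `L` i.i.d. uniform `q`-ary symbols
  (∀ i, ent q μ (W i) = L) ∧
  -- the inputs are mutually independent of each other and of all keys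
  (ent q μ (fun ω => (restr W Finset.univ ω, restr Z Finset.univ ω)) =
    ent q μ (restr Z Finset.univ) + ∑ i, ent q μ (W i)) ∧
  -- the source key consists of `LSig` i.i.d. uniform `q`-ary symbols
  (ent q μ ZS = LSig) ∧
  -- the individual keys are deterministic functions of the source key
  (condEnt q μ (restr Z Finset.univ) ZS = 0) ∧
  -- each user message is a deterministic function of its input and key
  (∀ i, condEnt q μ (X i) (fun ω => (W i ω, Z i ω)) = 0) ∧
  -- each server message is a deterministic function of its received messages
  (∀ u, condEnt q μ (Y u) (restr X (Ksrv U V u)) = 0) ∧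
  -- correctness
  (∀ k, condEnt q μ (fun ω => ∑ i, W i ω)
    (fun ω => (restr Y (Finset.univ.erase k) ω, restr X (Ksrv U V k) ω)) = 0) ∧
  -- security
  (∀ k m n, mutInfo q μ
    (fun ω => (restr Y (Finset.univ.erase k) ω, restr X (Ksrv U V k) ω))
    (restr W (S m))
    (fun ω => (∑ i, W i ω, restr W (T n) ω, restr Z (T n) ω)) = 0)

/-- A rate tuple `(R_X, R_Y, R_{Z_Σ})` is achievable. -/
def Achievable (U : ℕ) (V : Fin U → ℕ) (M N : ℕ) (S : Fin M → Finset (Usr U V))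
    (T : Fin N → Finset (Usr U V)) (R : ℝ × ℝ × ℝ) : Prop :=
  ∃ (F : Type) (iF : Field F) (iFt : Fintype F) (Ω : Type) (iΩ : Fintype Ω)
    (μ : Ω → ℝ) (L LX LY LZ LSig : ℕ)
    (W : Usr U V → Ω → Fin L → F) (Z : Usr U V → Ω → Fin LZ → F)
    (X : Usr U V → Ω → Fin LX → F) (Y : Fin U → Ω → Fin LY → F)
    (ZS : Ω → Fin LSig → F),
    R.1 = (LX : ℝ) / (L : ℝ) ∧ R.2.1 = (LY : ℝ) / (L : ℝ) ∧ R.2.2 = (LSig : ℝ) / (L : ℝ) ∧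
    @IsScheme U V M N S T F iF iFt Ω iΩ μ L LX LY LZ LSig W Z X Y ZS

end

theorem restr_eq_iff {Ω ι α : Type} (Z : ι → Ω → α) (A : Finset ι) (ω ω' : Ω) :
    restr Z A ω = restr Z A ω' ↔ ∀ i ∈ A, Z i ω = Z i ω' := by
  simp [restr, funext_iff]

section Entropy

variable {Ω : Type} [Fintype Ω] {μ : Ω → ℝ} {α β γ : Type}

/-- `X` is a function of `Y` on the support of the weights `μ`. -/
def DeterminedBy (μ : Ω → ℝ) (X : Ω → α) (Y : Ω → β) : Prop :=
  ∀ ω ω', 0 < μ ω → 0 < μ ω' → Y ω = Y ω' → X ω = X ω'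

theorem sum_mul_comp_eq_sum_prb [Fintype α] (X : Ω → α) (g : α → ℝ) :
    ∑ ω, μ ω * g (X ω) = ∑ s, prb μ X s * g s := by
  rw [← Finset.sum_fiberwise (s := Finset.univ) (g := X)]
  refine Finset.sum_congr rfl fun s _ => ?_
  rw [prb, Finset.sum_mul]
  refine Finset.sum_congr (by ext; simp) fun ω hω => ?_
  simp only [Finset.mem_filter] at hω
  rw [hω.2]

theorem ent_eq_sum_log (q : ℕ) [Fintype α] (X : Ω → α) :
    ent q μ X = -(∑ ω, μ ω * Real.log (prb μ X (X ω))) / Real.log q := by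
  rw [ent, sum_mul_comp_eq_sum_prb X (fun s => Real.log (prb μ X s)), neg_div, Finset.sum_div]
  simp only [Real.logb, mul_div_assoc]

theorem prb_nonneg (hμ : ∀ ω, 0 ≤ μ ω) (X : Ω → α) (s : α) : 0 ≤ prb μ X s :=
  Finset.sum_nonneg fun ω _ => hμ ω

theorem le_prb (hμ : ∀ ω, 0 ≤ μ ω) (X : Ω → α) (ω : Ω) : μ ω ≤ prb μ X (X ω) :=
  Finset.single_le_sum (f := μ) (fun ω _ => hμ ω) (by simp)

theorem prb_pos (hμ : ∀ ω, 0 ≤ μ ω) (X : Ω → α) {ω : Ω} (h : 0 < μ ω) : 0 < prb μ X (X ω) :=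
  h.trans_le (le_prb hμ X ω)

theorem sum_prb_prod [Fintype α] (X : Ω → α) (Y : Ω → β) (t : β) :
    ∑ s, prb μ (fun ω => (X ω, Y ω)) (s, t) = prb μ Y t := by
  simp only [prb, Prod.mk.injEq]
  rw [← Finset.sum_fiberwise (s := Finset.univ.filter fun ω => Y ω = t) (g := X)]
  refine Finset.sum_congr rfl fun s _ => Finset.sum_congr ?_ fun _ _ => rfl
  ext ω
  simp [and_comm]

theorem sum_prb [Fintype α] (X : Ω → α) : ∑ s, prb μ X s = ∑ ω, μ ω := by
  simpa using (sum_mul_comp_eq_sum_prb (μ := μ) X fun _ => 1).symm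

theorem DeterminedBy.prb_le (hμ : ∀ ω, 0 ≤ μ ω) {X : Ω → α} {Y : Ω → β}
    (h : DeterminedBy μ X Y) {ω : Ω} (hω : 0 < μ ω) : prb μ Y (Y ω) ≤ prb μ X (X ω) := by
  unfold prb
  rw [Finset.sum_filter, Finset.sum_filter]
  refine Finset.sum_le_sum fun ω' _ => ?_
  rcases (hμ ω').eq_or_lt with h0 | h0
  · simp [← h0]
  by_cases hY : Y ω' = Y ω
  · simp [hY, h ω' ω h0 hω hY]
  · rw [if_neg hY]
    split_ifs <;> simp [hμ]

theorem DeterminedBy.ent_le (q : ℕ) (hμ : ∀ ω, 0 ≤ μ ω) [Fintype α] [Fintype β]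
    {X : Ω → α} {Y : Ω → β} (h : DeterminedBy μ X Y) : ent q μ X ≤ ent q μ Y := by
  rw [ent_eq_sum_log, ent_eq_sum_log]
  refine div_le_div_of_nonneg_right (neg_le_neg (Finset.sum_le_sum fun ω _ => ?_))
    (Real.log_natCast_nonneg q)
  rcases (hμ ω).eq_or_lt with h0 | h0
  · simp [← h0]
  · exact mul_le_mul_of_nonneg_left
      (Real.log_le_log (prb_pos hμ Y h0) (h.prb_le hμ h0)) h0.le

theorem ent_eq_of_determinedBy (q : ℕ) (hμ : ∀ ω, 0 ≤ μ ω) [Fintype α] [Fintype β]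
    {X : Ω → α} {Y : Ω → β} (h : DeterminedBy μ X Y) (h' : DeterminedBy μ Y X) :
    ent q μ X = ent q μ Y :=
  le_antisymm (h.ent_le q hμ) (h'.ent_le q hμ)

theorem determinedBy_of_condEnt_eq_zero {q : ℕ} (hq : 1 < q) (hμ : ∀ ω, 0 ≤ μ ω)
    [Fintype α] [Fintype β] {X : Ω → α} {Y : Ω → β} (h : condEnt q μ X Y = 0) :
    DeterminedBy μ X Y := by
  have hdet : DeterminedBy μ Y fun ω => (X ω, Y ω) := fun _ _ _ _ h => (Prod.ext_iff.1 h).2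
  have hlog : 0 < Real.log q := Real.log_pos (by exact_mod_cast hq)
  rw [condEnt, ent_eq_sum_log, ent_eq_sum_log, ← sub_div, div_eq_zero_iff,
    or_iff_left hlog.ne', neg_sub_neg, ← Finset.sum_sub_distrib,
    Finset.sum_eq_zero_iff_of_nonneg] at h
  · intro ω ω' hω hω' hY
    have hω0 := h ω (Finset.mem_univ _)
    rw [← mul_sub, mul_eq_zero, or_iff_right hω.ne', sub_eq_zero] at hω0
    have heq := Real.log_injOn_pos (Set.mem_Ioi.2 (prb_pos hμ Y hω))
      (Set.mem_Ioi.2 (prb_pos hμ (fun ω => (X ω, Y ω)) hω)) hω0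
    by_contra hX
    have hlt : prb μ (fun ω => (X ω, Y ω)) (X ω, Y ω) < prb μ Y (Y ω) := by
      refine Finset.sum_lt_sum_of_subset (i := ω') ?_ ?_ ?_ hω' fun _ _ _ => hμ _
      · intro a
        simp +contextual
      · simp [hY]
      · simp [Ne.symm hX]
    exact hlt.ne heq.symm
  · intro ω _
    rw [← mul_sub]
    rcases (hμ ω).eq_or_lt with h0 | h0
    · simp [← h0]
    · exact mul_nonneg h0.le (sub_nonneg.2
        (Real.log_le_log (prb_pos hμ (fun ω => (X ω, Y ω)) h0) (hdet.prb_le hμ h0)))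

theorem condEnt_prod_le (q : ℕ) (hμ : ∀ ω, 0 ≤ μ ω)
    [Fintype α] [Fintype β] [Fintype γ] (X : Ω → α) (Y : Ω → β) (Z : Ω → γ) :
    condEnt q μ X (fun ω => (Y ω, Z ω)) ≤ condEnt q μ X Z := by
  set pXYZ := prb μ fun ω => (X ω, Y ω, Z ω)
  set pXZ := prb μ fun ω => (X ω, Z ω)
  set pYZ := prb μ fun ω => (Y ω, Z ω)
  set pZ := prb μ Z
  let r : α × β × γ → ℝ := fun t =>
    pXZ (t.1, t.2.2) * pYZ t.2 / (pXYZ t * pZ t.2.2)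
  have hr : ∑ ω, μ ω * r (X ω, Y ω, Z ω) ≤ ∑ ω, μ ω := by
    calc ∑ ω, μ ω * r (X ω, Y ω, Z ω) = ∑ t, pXYZ t * r t :=
          sum_mul_comp_eq_sum_prb (fun ω => (X ω, Y ω, Z ω)) r
      _ ≤ ∑ t : α × β × γ, pXZ (t.1, t.2.2) * pYZ t.2 / pZ t.2.2 := by
          refine Finset.sum_le_sum fun t _ => ?_
          have h1 : 0 ≤ pXZ (t.1, t.2.2) * pYZ t.2 / pZ t.2.2 :=
            div_nonneg (mul_nonneg (prb_nonneg hμ _ _) (prb_nonneg hμ _ _)) (prb_nonneg hμ _ _)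
          rcases eq_or_ne (pXYZ t) 0 with h0 | h0
          · simpa [h0] using h1
          · refine le_of_eq ?_
            simp only [r]
            rw [← div_div, mul_div_assoc', mul_div_cancel₀ _ h0]
      _ = ∑ z, pZ z := by
          rw [Fintype.sum_prod_type_right, Fintype.sum_prod_type_right]
          refine Finset.sum_congr rfl fun z _ => ?_
          simp_rw [← Finset.sum_div, ← Finset.sum_mul, ← Finset.mul_sum]
          rw [sum_prb_prod, sum_prb_prod]
          exact mul_self_div_self _
      _ = ∑ ω, μ ω := sum_prb Z
  simp only [condEnt, ent_eq_sum_log, ← sub_div]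
  refine div_le_div_of_nonneg_right ?_ (Real.log_natCast_nonneg q)
  have key : ∀ ω, μ ω * Real.log (pXZ (X ω, Z ω)) + μ ω * Real.log (pYZ (Y ω, Z ω))
      - μ ω * Real.log (pXYZ (X ω, Y ω, Z ω)) - μ ω * Real.log (pZ (Z ω))
      ≤ μ ω * r (X ω, Y ω, Z ω) - μ ω := by
    intro ω
    rcases (hμ ω).eq_or_lt with h0 | h0
    · simp [← h0]
    have h1 : 0 < pXZ (X ω, Z ω) := prb_pos hμ (fun ω => (X ω, Z ω)) h0
    have h2 : 0 < pYZ (Y ω, Z ω) := prb_pos hμ (fun ω => (Y ω, Z ω)) h0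
    have h3 : 0 < pXYZ (X ω, Y ω, Z ω) := prb_pos hμ (fun ω => (X ω, Y ω, Z ω)) h0
    have h4 : 0 < pZ (Z ω) := prb_pos hμ Z h0
    have h5 := Real.log_le_sub_one_of_pos (div_pos (mul_pos h1 h2) (mul_pos h3 h4))
    rw [Real.log_div (mul_pos h1 h2).ne' (mul_pos h3 h4).ne', Real.log_mul h1.ne' h2.ne',
      Real.log_mul h3.ne' h4.ne'] at h5
    have h6 := mul_le_mul_of_nonneg_left h5 h0.le
    simp only [r]
    linarith
  have hsum := Finset.sum_le_sum fun ω (_ : ω ∈ Finset.univ) => key ω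
  simp only [Finset.sum_sub_distrib, Finset.sum_add_distrib] at hsum
  linarith

theorem DeterminedBy.condEnt_le (q : ℕ) (hμ : ∀ ω, 0 ≤ μ ω)
    [Fintype α] [Fintype β] [Fintype γ] (X : Ω → α) {Y : Ω → β} {Y' : Ω → γ}
    (h : DeterminedBy μ Y Y') : condEnt q μ X Y' ≤ condEnt q μ X Y := by
  refine le_trans (le_of_eq ?_) (condEnt_prod_le q hμ X Y' Y)
  unfold condEnt
  congr 1 <;> refine ent_eq_of_determinedBy q hμ ?_ ?_ <;> intro ω ω' hω hω' he <;>
    simp only [Prod.mk.injEq] at he ⊢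
  · exact he.imp_right And.left
  · exact ⟨he.1, he.2, h ω ω' hω hω' he.2⟩
  · exact he.1
  · exact ⟨he, h ω ω' hω hω' he⟩

theorem condEnt_le_ent (q : ℕ) (hμ : ∀ ω, 0 ≤ μ ω) (hμ1 : ∑ ω, μ ω = 1)
    [Fintype α] [Fintype β] (X : Ω → α) (Y : Ω → β) : condEnt q μ X Y ≤ ent q μ X := by
  have hconst : DeterminedBy μ (fun _ : Ω => ()) Y := fun _ _ _ _ _ => rfl
  refine (hconst.condEnt_le q hμ X).trans (le_of_eq ?_)
  have h0 : ent q μ (fun _ : Ω => ()) = 0 := by simp [ent, prb, hμ1]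
  rw [condEnt, h0, sub_zero]
  exact ent_eq_of_determinedBy q hμ (fun _ _ _ _ he => by simpa using he)
    (fun _ _ _ _ he => by simpa using he)

theorem ent_restr_prod_le (q : ℕ) (hμ : ∀ ω, 0 ≤ μ ω) (hμ1 : ∑ ω, μ ω = 1)
    [Fintype α] [Fintype β] {ι : Type} [DecidableEq ι] (W : ι → Ω → α) (Z : Ω → β) (A : Finset ι) :
    ent q μ (fun ω => (restr W A ω, Z ω)) ≤ ent q μ Z + ∑ i ∈ A, ent q μ (W i) := by
  induction A using Finset.induction_on with
  | empty =>
    simp only [Finset.sum_empty, add_zero]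
    refine DeterminedBy.ent_le q hμ fun ω ω' _ _ h => ?_
    simp [restr_eq_iff, h]
  | insert a A ha ih =>
    have h1 := condEnt_le_ent q hμ hμ1 (W a) fun ω => (restr W A ω, Z ω)
    have h2 : ent q μ (fun ω => (restr W (insert a A) ω, Z ω)) ≤
        ent q μ (fun ω => (W a ω, restr W A ω, Z ω)) := by
      refine DeterminedBy.ent_le q hμ fun ω ω' _ _ h => ?_
      simpa [restr_eq_iff, and_assoc] using h
    rw [condEnt] at h1
    rw [Finset.sum_insert ha]
    linarith

theorem le_condEnt_of_independent (q : ℕ) (hμ : ∀ ω, 0 ≤ μ ω) (hμ1 : ∑ ω, μ ω = 1)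
    [Fintype α] [Fintype β] {ι : Type} [Fintype ι]
    [DecidableEq ι] (W : ι → Ω → α) (Z : ι → Ω → β)
    (hInd : ent q μ (fun ω => (restr W Finset.univ ω, restr Z Finset.univ ω)) =
      ent q μ (restr Z Finset.univ) + ∑ i, ent q μ (W i)) (i : ι) :
    ent q μ (W i) ≤ condEnt q μ (W i)
      (fun ω => (restr W (Finset.univ.erase i) ω, restr Z (Finset.univ.erase i) ω)) := by
  have hdet : DeterminedBy μ
      (fun ω => (restr W (Finset.univ.erase i) ω, restr Z (Finset.univ.erase i) ω))
      (fun ω => (restr W (Finset.univ.erase i) ω, restr Z Finset.univ ω)) := by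
    intro ω ω' _ _ h
    simp only [Prod.mk.injEq, restr_eq_iff] at h ⊢
    exact ⟨h.1, fun j _ => h.2 j (Finset.mem_univ j)⟩
  refine le_trans ?_ (hdet.condEnt_le q hμ (W i))
  have h1 := ent_restr_prod_le q hμ hμ1 W (restr Z Finset.univ) (Finset.univ.erase i)
  have h2 : ent q μ (fun ω => (restr W Finset.univ ω, restr Z Finset.univ ω)) ≤
      ent q μ (fun ω => (W i ω, restr W (Finset.univ.erase i) ω, restr Z Finset.univ ω)) := by
    refine DeterminedBy.ent_le q hμ fun ω ω' _ _ h => ?_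
    simp only [Prod.mk.injEq, restr_eq_iff] at h ⊢
    refine ⟨fun j _ => ?_, h.2.2⟩
    rcases eq_or_ne j i with rfl | hj
    · exact h.1
    · exact h.2.1 j (Finset.mem_erase.2 ⟨hj, Finset.mem_univ j⟩)
  have h3 := Finset.add_sum_erase Finset.univ (fun j => ent q μ (W j)) (Finset.mem_univ i)
  rw [condEnt]
  linarith

end Entropy

/-- Given the inputs and keys of all other users, a message that determines the sum of the
inputs carries at least the entropy of its own input. -/
theorem ent_le_condEnt_message (q : ℕ) {Ω : Type} [Fintype Ω] {μ : Ω → ℝ} (hμ : ∀ ω, 0 ≤ μ ω)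
    (hμ1 : ∑ ω, μ ω = 1) {α β ξ ι : Type} [AddCommGroup α] [Fintype α] [Fintype β] [Fintype ξ]
    [Fintype ι] [DecidableEq ι] (W : ι → Ω → α) (Z : ι → Ω → β) (X : ι → Ω → ξ)
    (hInd : ent q μ (fun ω => (restr W Finset.univ ω, restr Z Finset.univ ω)) =
      ent q μ (restr Z Finset.univ) + ∑ i, ent q μ (W i))
    (hX : ∀ i, DeterminedBy μ (X i) fun ω => (W i ω, Z i ω))
    (hsum : DeterminedBy μ (fun ω => ∑ i, W i ω) (restr X Finset.univ)) (i : ι) :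
    ent q μ (W i) ≤ condEnt q μ (X i)
      (fun ω => (restr W (Finset.univ.erase i) ω, restr Z (Finset.univ.erase i) ω)) := by
  refine (le_condEnt_of_independent q hμ hμ1 W Z hInd i).trans
    (sub_le_sub_right (DeterminedBy.ent_le q hμ fun ω ω' hω hω' h => ?_) _)
  simp only [Prod.mk.injEq, restr_eq_iff] at h ⊢
  refine ⟨?_, h.2⟩
  have hs := hsum ω ω' hω hω' <| (restr_eq_iff _ _ _ _).2 fun j _ => by
    rcases eq_or_ne j i with rfl | hj
    · exact h.1
    · have hj' : j ∈ Finset.univ.erase i := Finset.mem_erase.2 ⟨hj, Finset.mem_univ j⟩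
      exact hX j ω ω' hω hω' (Prod.ext (h.2.1 j hj') (h.2.2 j hj'))
  simp only [← Finset.add_sum_erase Finset.univ _ (Finset.mem_univ i)] at hs
  rw [Finset.sum_congr rfl h.2.1] at hs
  exact add_right_cancel hs

theorem stmt9_lemma3_X
    (U : ℕ) (hU : 3 ≤ U) (V : Fin U → ℕ) (hV : ∀ u, 1 ≤ V u)
    (F : Type) [Field F] [Fintype F] (Ω : Type) [Fintype Ω] (μ : Ω → ℝ)
    (hμ0 : ∀ ω, 0 ≤ μ ω) (hμ1 : ∑ ω, μ ω = 1)
    (L LX LY LZ : ℕ) (hL : 1 ≤ L)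
    (W : Usr U V → Ω → Fin L → F) (Z : Usr U V → Ω → Fin LZ → F)
    (X : Usr U V → Ω → Fin LX → F) (Y : Fin U → Ω → Fin LY → F)
    (hWent : ∀ i, ent (Fintype.card F) μ (W i) = L)
    (hInd : ent (Fintype.card F) μ (fun ω => (restr W Finset.univ ω, restr Z Finset.univ ω)) =
      ent (Fintype.card F) μ (restr Z Finset.univ) + ∑ i, ent (Fintype.card F) μ (W i))
    (hX : ∀ i, condEnt (Fintype.card F) μ (X i) (fun ω => (W i ω, Z i ω)) = 0)
    (hY : ∀ u, condEnt (Fintype.card F) μ (Y u) (restr X (Ksrv U V u)) = 0)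
    (hCorr : ∀ k, condEnt (Fintype.card F) μ (fun ω => ∑ i, W i ω)
      (fun ω => (restr Y (Finset.univ.erase k) ω, restr X (Ksrv U V k) ω)) = 0) :
    ∀ (u' : Fin U) (Vs : Finset (Fin (V u'))) (Tc : Finset (Usr U V)),
      (∀ v ∈ Vs, (⟨u', v⟩ : Usr U V) ∉ Tc) →
      (Vs.card : ℝ) * L ≤ condEnt (Fintype.card F) μ
        (fun ω (v : { x // x ∈ Vs }) => X ⟨u', v.1⟩ ω)
        (fun ω => (restr W Tc ω, restr Z Tc ω)) := by
  intro u' Vs Tc hVT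
  have hq : 1 < Fintype.card F := Fintype.one_lt_card
  have hXd := fun i => determinedBy_of_condEnt_eq_zero hq hμ0 (hX i)
  have hYd := fun u => determinedBy_of_condEnt_eq_zero hq hμ0 (hY u)
  have hsum : DeterminedBy μ (fun ω => ∑ i, W i ω) (restr X Finset.univ) := by
    intro ω ω' hω hω' h
    rw [restr_eq_iff] at h
    have hr : ∀ u, restr X (Ksrv U V u) ω = restr X (Ksrv U V u) ω' := fun u =>
      (restr_eq_iff _ _ _ _).2 fun i _ => h i (Finset.mem_univ i)
    exact determinedBy_of_condEnt_eq_zero hq hμ0 (hCorr u') ω ω' hω hω' <|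
      Prod.ext ((restr_eq_iff _ _ _ _).2 fun u _ => hYd u ω ω' hω hω' (hr u)) (hr u')
  induction Vs using Finset.induction_on with
  | empty =>
    simp only [Finset.card_empty, Nat.cast_zero, zero_mul, condEnt, sub_nonneg]
    exact DeterminedBy.ent_le _ hμ0 fun _ _ _ _ h => (Prod.ext_iff.1 h).2
  | insert a A ha ih =>
    have ih := ih fun v hv => hVT v (Finset.mem_insert_of_mem hv)
    have hmsg := ent_le_condEnt_message _ hμ0 hμ1 W Z X hInd hXd hsum ⟨u', a⟩
    rw [hWent] at hmsg
    have hdet : DeterminedBy μ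
        (fun ω => ((fun v : { x // x ∈ A } => X ⟨u', v.1⟩ ω), restr W Tc ω, restr Z Tc ω))
        (fun ω => (restr W (Finset.univ.erase (⟨u', a⟩ : Usr U V)) ω,
          restr Z (Finset.univ.erase (⟨u', a⟩ : Usr U V)) ω)) := by
      intro ω ω' hω hω' h
      simp only [Prod.mk.injEq, restr_eq_iff, Finset.mem_erase, Finset.mem_univ, and_true] at h ⊢
      have hT : ∀ i ∈ Tc, i ≠ ⟨u', a⟩ := by
        rintro i hi rfl
        exact hVT a (Finset.mem_insert_self a A) hi
      refine ⟨funext fun v => ?_, fun i hi => h.1 i (hT i hi), fun i hi => h.2 i (hT i hi)⟩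
      have hv : (⟨u', v.1⟩ : Usr U V) ≠ ⟨u', a⟩ := by
        intro he
        have hva : v.1 = a := by simpa using he
        exact ha (hva ▸ v.2)
      exact hXd _ ω ω' hω hω' (Prod.ext (h.1 _ hv) (h.2 _ hv))
    have hstep := hmsg.trans (hdet.condEnt_le (Fintype.card F) hμ0 (X ⟨u', a⟩))
    have hle : ent (Fintype.card F) μ (fun ω => (X ⟨u', a⟩ ω,
          (fun v : { x // x ∈ A } => X ⟨u', v.1⟩ ω), restr W Tc ω, restr Z Tc ω)) ≤
        ent (Fintype.card F) μ (fun ω =>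
          ((fun v : { x // x ∈ insert a A } => X ⟨u', v.1⟩ ω), restr W Tc ω, restr Z Tc ω)) := by
      refine DeterminedBy.ent_le _ hμ0 fun ω ω' _ _ h => ?_
      simp only [Prod.mk.injEq] at h ⊢
      exact ⟨congrFun h.1 ⟨a, Finset.mem_insert_self a A⟩,
        funext fun v => congrFun h.1 ⟨v.1, Finset.mem_insert_of_mem v.2⟩, h.2⟩
    rw [Finset.card_insert_of_notMem ha]
    push_cast
    simp only [condEnt] at ih hstep ⊢
    linarith
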